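/- Let F be a field, let H1 and H2 be groups, and let τ1: H1 → Aut_F(W1) and τ2: H2 → Aut_F(W2) be finite-dimensional F-linear representations. Set F1 = End_{H1}(W1) and F2 = End_{H2}(W2), and assume both F1 and F2 are fields. Then the F-algebra homomorphism F1 ⊗_F F2 → End_F(Hom_F(W1,W2)) sending f1 ⊗ f2 to the operator φ ↦ f2 ∘ φ ∘ f1 is injective, and its image is exactly the centralizer End_{H1×H2}(Hom_F(W1,W2)) of H1 × H2 in End_F(Hom_F(W1,W2)), for the representation in which (h1,h2) sends φ to τ2(h2) ∘ φ ∘ τ1(h1)^{-1}. -/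

import Mathlib

open TensorProduct

set_option synthInstance.maxHeartbeats 1000000
set_option maxHeartbeats 1000000

/-- The centralizer `End_H(W)` of a linear representation `τ : H →* Aut_F(W)`
inside `End_F(W)`. -/
def reprCentralizer (F : Type*) [Field F] {H : Type*} [Group H]
    {W : Type*} [AddCommGroup W] [Module F W] (τ : H →* (W ≃ₗ[F] W)) :
    Subalgebra F (Module.End F W) :=
  Subalgebra.centralizer F (Set.range fun h : H => ((τ h : W →ₗ[F] W) : Module.End F W))

theorem exists_sandwich (F : Type*) [Field F]
    (W1 W2 : Type*) [AddCommGroup W1] [Module F W1] [AddCommGroup W2] [Module F W2]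
    [FiniteDimensional F W1] [FiniteDimensional F W2] :
    ∃ Ψ : TensorProduct F (Module.End F W1) (Module.End F W2) ≃ₗ[F] Module.End F (W1 →ₗ[F] W2),
      ∀ (a : Module.End F W1) (b : Module.End F W2) (φ : W1 →ₗ[F] W2),
        Ψ (a ⊗ₜ[F] b) φ = b ∘ₗ φ ∘ₗ a := by
  have hinj : Function.Injective
      (Module.Dual.transpose (R := F) (M := W1) (M' := W1)) := by
    intro a b hab
    ext w
    rw [← sub_eq_zero, ← Module.forall_dual_apply_eq_zero_iff F]
    intro f
    have := LinearMap.congr_fun (LinearMap.congr_fun hab f) w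
    rw [map_sub, sub_eq_zero]
    exact this
  have hfin : Module.finrank F (W1 →ₗ[F] W1) =
      Module.finrank F (Module.Dual F W1 →ₗ[F] Module.Dual F W1) := by
    have h : Module.finrank F (Module.Dual F W1) = Module.finrank F W1 :=
      Subspace.dual_finrank_eq
    have h1 := Module.finrank_linearMap F F W1 W1
    have h2 := Module.finrank_linearMap F F (Module.Dual F W1) (Module.Dual F W1)
    exact h1.trans (h2.trans (by rw [h])).symm
  let t : (W1 →ₗ[F] W1) ≃ₗ[F] (Module.Dual F W1 →ₗ[F] Module.Dual F W1) :=
    LinearMap.linearEquivOfInjective (V := W1 →ₗ[F] W1)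
      (V₂ := Module.Dual F W1 →ₗ[F] Module.Dual F W1)
      (Module.Dual.transpose (R := F) (M := W1) (M' := W1)) hinj hfin
  have ht : ∀ (a : W1 →ₗ[F] W1) (f : Module.Dual F W1), t a f = f ∘ₗ a := fun a f => rfl
  let D := dualTensorHomEquiv F W1 W2
  let Ψ : TensorProduct F (W1 →ₗ[F] W1) (W2 →ₗ[F] W2) ≃ₗ[F] ((W1 →ₗ[F] W2) →ₗ[F] (W1 →ₗ[F] W2)) :=
    (TensorProduct.congr t (LinearEquiv.refl F (W2 →ₗ[F] W2))).trans
      ((homTensorHomEquiv F (Module.Dual F W1) W2 (Module.Dual F W1) W2).trans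
        (LinearEquiv.arrowCongr D D))
  refine ⟨Ψ, fun a b φ => ?_⟩
  obtain ⟨x, rfl⟩ := D.surjective φ
  have h1 : Ψ (a ⊗ₜ[F] b) (D x) = D (TensorProduct.map (t a) b x) := by
    simp [Ψ, LinearEquiv.arrowCongr_apply, -dualTensorHomEquiv]
  refine h1.trans ?_
  induction x using TensorProduct.induction_on with
  | zero => simp
  | add x y hx hy =>
    have hx' := hx (by simp [Ψ, LinearEquiv.arrowCongr_apply, -dualTensorHomEquiv])
    have hy' := hy (by simp [Ψ, LinearEquiv.arrowCongr_apply, -dualTensorHomEquiv])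
    rw [map_add, map_add, hx', hy', map_add, LinearMap.add_comp, LinearMap.comp_add]
  | tmul f w =>
    ext v
    simp [D, ht]

theorem centralizer_tensor (F : Type*) [Field F] (A B : Type*) [Ring A] [Algebra F A]
    [Ring B] [Algebra F B] (S : Set A) (T : Set B) (x : TensorProduct F A B)
    (hS : ∀ s ∈ S, (s ⊗ₜ[F] (1 : B)) * x = x * (s ⊗ₜ[F] 1))
    (hT : ∀ t ∈ T, ((1 : A) ⊗ₜ[F] t) * x = x * (1 ⊗ₜ[F] t)) :
    ∃ y : TensorProduct F (Subalgebra.centralizer F S) (Subalgebra.centralizer F T),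
      TensorProduct.map (Subalgebra.centralizer F S).val.toLinearMap
        (Subalgebra.centralizer F T).val.toLinearMap y = x := by
  have h1 : x ∈ Subalgebra.centralizer F
      (Algebra.TensorProduct.includeLeft (R := F) (S := F) (A := A) (B := B) '' S) := by
    rw [Subalgebra.mem_centralizer_iff]
    rintro _ ⟨s, hs, rfl⟩
    exact hS s hs
  rw [Subalgebra.centralizer_coe_image_includeLeft_eq_center_tensorProduct] at h1
  generalize Subalgebra.centralizer F S = C at *
  obtain ⟨z, rfl⟩ := h1
  have hinj : Function.Injective (Algebra.TensorProduct.map C.val (AlgHom.id F B)) :=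
    TensorProduct.map_injective_of_flat_flat C.val.toLinearMap (AlgHom.id F B).toLinearMap
      Subtype.val_injective Function.injective_id
  have h2 : z ∈ Subalgebra.centralizer F
      (Algebra.TensorProduct.includeRight (R := F) (A := C) (B := B) '' T) := by
    rw [Subalgebra.mem_centralizer_iff]
    rintro _ ⟨t, ht, rfl⟩
    apply hinj
    have := hT t ht
    simpa using! this
  rw [Subalgebra.centralizer_coe_image_includeRight_eq_center_tensorProduct] at h2
  obtain ⟨y, rfl⟩ := h2
  refine ⟨y, ?_⟩
  clear hS hT
  induction y using TensorProduct.induction_on with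
  | zero => simp
  | add x y hx hy => simp only [map_add, hx, hy]
  | tmul f w => simp

/-- If `F1 = End_{H1}(W1)` and `F2 = End_{H2}(W2)` are fields, then any `F`-linear map
`Φ : F1 ⊗_F F2 → End_F(Hom_F(W1, W2))` sending `f1 ⊗ f2` to `φ ↦ f2 ∘ φ ∘ f1` is
multiplicative (i.e. an `F`-algebra homomorphism), injective, and its image is exactly
the centralizer of `H1 × H2` in `End_F(Hom_F(W1, W2))`, where `(h1, h2)` acts on `φ`
by `τ2 h2 ∘ φ ∘ (τ1 h1)⁻¹`. -/
theorem tensor_centralizers_image_eq_centralizer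
    (F : Type*) [Field F] {H1 H2 : Type*} [Group H1] [Group H2]
    {W1 W2 : Type*} [AddCommGroup W1] [Module F W1] [AddCommGroup W2] [Module F W2]
    [FiniteDimensional F W1] [FiniteDimensional F W2]
    (τ1 : H1 →* (W1 ≃ₗ[F] W1)) (τ2 : H2 →* (W2 ≃ₗ[F] W2))
    (hF1 : IsField (reprCentralizer F τ1))
    (hF2 : IsField (reprCentralizer F τ2))
    (Φ : TensorProduct F (reprCentralizer F τ1) (reprCentralizer F τ2)
          →ₗ[F] Module.End F (W1 →ₗ[F] W2))
    (hΦ : ∀ (f1 : reprCentralizer F τ1) (f2 : reprCentralizer F τ2) (φ : W1 →ₗ[F] W2),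
      Φ (f1 ⊗ₜ[F] f2) φ
        = (f2 : Module.End F W2) ∘ₗ φ ∘ₗ (f1 : Module.End F W1)) :
    (∀ x y, Φ (x * y) = Φ x * Φ y) ∧ Function.Injective Φ ∧
      Set.range Φ = (Subalgebra.centralizer F
        (Set.range fun p : H1 × H2 =>
          ((LinearEquiv.arrowCongr (τ1 p.1) (τ2 p.2) :
              (W1 →ₗ[F] W2) ≃ₗ[F] (W1 →ₗ[F] W2)) :
            Module.End F (W1 →ₗ[F] W2))) : Set (Module.End F (W1 →ₗ[F] W2))) := by
  obtain ⟨Ψ, hΨ⟩ := exists_sandwich F W1 W2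
  have hfac : ∀ x, Φ x = Ψ (TensorProduct.map (reprCentralizer F τ1).val.toLinearMap
      (reprCentralizer F τ2).val.toLinearMap x) := by
    intro x
    induction x using TensorProduct.induction_on with
    | zero => simp
    | add x y hx hy => rw [map_add, hx, hy, map_add, map_add]
    | tmul f g =>
      apply LinearMap.ext
      intro φ
      rw [hΦ, TensorProduct.map_tmul, hΨ]
      rfl
  refine ⟨?_, ?_, ?_⟩
  · intro x y
    induction x using TensorProduct.induction_on with
    | zero => simp
    | add x x' hx hx' => rw [add_mul, map_add, hx, hx', map_add, add_mul]
    | tmul f g =>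
      induction y using TensorProduct.induction_on with
      | zero => simp
      | add x x' hx hx' => rw [mul_add, map_add, hx, hx', map_add, mul_add]
      | tmul f' g' =>
        apply LinearMap.ext
        intro φ
        rw [Algebra.TensorProduct.tmul_mul_tmul, hΦ, Module.End.mul_apply, hΦ, hΦ, hF1.mul_comm f f']
        rfl
  · have hinj := TensorProduct.map_injective_of_flat_flat
      (reprCentralizer F τ1).val.toLinearMap (reprCentralizer F τ2).val.toLinearMap
      Subtype.val_injective Subtype.val_injective
    intro x y hxy
    rw [hfac, hfac] at hxy
    exact hinj (Ψ.injective hxy)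
  · apply Set.Subset.antisymm
    · rintro _ ⟨x, rfl⟩
      rw [SetLike.mem_coe]
      induction x using TensorProduct.induction_on with
      | zero => rw [map_zero]; exact Subalgebra.zero_mem _
      | add x y hx hy => rw [map_add]; exact Subalgebra.add_mem _ hx hy
      | tmul f g =>
        rw [Subalgebra.mem_centralizer_iff]
        rintro _ ⟨⟨h1, h2⟩, rfl⟩
        apply LinearMap.ext
        intro φ
        have hf := (Subalgebra.mem_centralizer_iff F).1 f.2 _ ⟨h1⁻¹, rfl⟩
        have hg := (Subalgebra.mem_centralizer_iff F).1 g.2 _ ⟨h2, rfl⟩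
        rw [Module.End.mul_apply, Module.End.mul_apply, hΦ]
        refine Eq.trans ?_ (hΦ f g _).symm
        ext w
        have hf' := LinearMap.congr_fun hf w
        have hg' := fun v => LinearMap.congr_fun hg v
        simp only [Module.End.mul_apply, map_inv] at hf' hg'
        have e1 : (τ1 h1).symm ((f : Module.End F W1) w) = (f : Module.End F W1) ((τ1 h1).symm w) := hf'
        have e2 : ∀ v, τ2 h2 ((g : Module.End F W2) v) = (g : Module.End F W2) (τ2 h2 v) := hg'
        simp [LinearEquiv.arrowCongr_apply, e1, e2]
    · intro X hX
      rw [SetLike.mem_coe, Subalgebra.mem_centralizer_iff] at hX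
      obtain ⟨x, rfl⟩ := Ψ.surjective X
      have kL : ∀ (b : Module.End F W2) (x) (φ : W1 →ₗ[F] W2),
          Ψ (((1 : Module.End F W1) ⊗ₜ[F] b) * x) φ = b ∘ₗ (Ψ x φ) := by
        intro b x φ
        induction x using TensorProduct.induction_on with
        | zero => simp
        | add x y hx hy => simp only [mul_add, map_add, LinearMap.add_apply, hx, hy, LinearMap.comp_add]
        | tmul f g => rw [Algebra.TensorProduct.tmul_mul_tmul, hΨ, hΨ]; rfl
      have kR : ∀ (b : Module.End F W2) (x) (φ : W1 →ₗ[F] W2),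
          Ψ (x * ((1 : Module.End F W1) ⊗ₜ[F] b)) φ = Ψ x (b ∘ₗ φ) := by
        intro b x φ
        induction x using TensorProduct.induction_on with
        | zero => simp
        | add x y hx hy => simp only [add_mul, map_add, LinearMap.add_apply, hx, hy]
        | tmul f g => rw [Algebra.TensorProduct.tmul_mul_tmul, hΨ, hΨ]; rfl
      have lL : ∀ (a : Module.End F W1) (x) (φ : W1 →ₗ[F] W2),
          Ψ ((a ⊗ₜ[F] (1 : Module.End F W2)) * x) φ = Ψ x (φ ∘ₗ a) := by
        intro b x φ
        induction x using TensorProduct.induction_on with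
        | zero => simp
        | add x y hx hy => simp only [mul_add, map_add, LinearMap.add_apply, hx, hy]
        | tmul f g => rw [Algebra.TensorProduct.tmul_mul_tmul, hΨ, hΨ]; rfl
      have lR : ∀ (a : Module.End F W1) (x) (φ : W1 →ₗ[F] W2),
          Ψ (x * (a ⊗ₜ[F] (1 : Module.End F W2))) φ = (Ψ x φ) ∘ₗ a := by
        intro b x φ
        induction x using TensorProduct.induction_on with
        | zero => simp
        | add x y hx hy => simp only [add_mul, map_add, LinearMap.add_apply, hx, hy, LinearMap.add_comp]
        | tmul f g => rw [Algebra.TensorProduct.tmul_mul_tmul, hΨ, hΨ]; rfl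
      have key : ∀ h1 h2 φ, ((τ2 h2 : W2 →ₗ[F] W2) ∘ₗ (Ψ x φ) ∘ₗ ((τ1 h1).symm : W1 →ₗ[F] W1))
          = Ψ x ((τ2 h2 : W2 →ₗ[F] W2) ∘ₗ φ ∘ₗ ((τ1 h1).symm : W1 →ₗ[F] W1)) := fun h1 h2 φ =>
        LinearMap.congr_fun (hX _ ⟨(h1, h2), rfl⟩) φ
      obtain ⟨y, hy⟩ := centralizer_tensor F (Module.End F W1) (Module.End F W2)
        (Set.range fun h : H1 => ((τ1 h : W1 →ₗ[F] W1) : Module.End F W1))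
        (Set.range fun h : H2 => ((τ2 h : W2 →ₗ[F] W2) : Module.End F W2)) x
        (by
          rintro _ ⟨h, rfl⟩
          apply Ψ.injective
          apply LinearMap.ext
          intro φ
          have := key h⁻¹ 1 φ
          rw [map_inv, map_one] at this
          rw [lL, lR]
          exact this.symm)
        (by
          rintro _ ⟨h, rfl⟩
          apply Ψ.injective
          apply LinearMap.ext
          intro φ
          have := key 1 h φ
          rw [map_one] at this
          rw [kL, kR]
          exact this)
      exact ⟨y, (hfac y).trans (congrArg Ψ hy)⟩
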